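/- Let m ≥ 2, let V ⊆ ℝ^m be open with coordinates (z₀, z₁, z₂, …, z_{m−1}) = (x, t, τ₁, …, τ_{m−2}), and let Θ¹, Θ², Θ³ : V → ℝ^m be smooth coefficient maps of one-forms satisfying the structure equations of a pseudo-spherical surface in m variables, such that Θ¹₀·Θ²₁ − Θ¹₁·Θ²₀ ≠ 0 everywhere on V. Define on the half-space {t̂ > 0} ⊆ ℝ^m the hyperbolic coframe σ¹ = σ³ with components σ¹₀ = 1/t̂, σ¹₁ = 0, σ¹_j = 1/t̂ for j ≥ 2, and σ² with components σ²₁ = 1/t̂ and all other components 0. Then for every p ∈ V there exist an open neighborhood U ⊆ V of p, a smooth function θ : U → ℝ, and smooth functions α, β : U → ℝ with β > 0, such that the map Γ : U → ℝ^m, Γ(z) = (α(z), β(z), z₂, …, z_{m−1}), has everywhere nonvanishing Jacobian determinant and satisfies, for every index A, the pullback relations (Γ*σ¹)_A = Θ¹_A cos θ + Θ²_A sin θ, (Γ*σ²)_A = −Θ¹_A sin θ + Θ²_A cos θ, and (Γ*σ³)_A = Θ³_A + ∂_A θ, where (Γ*σ)_A = Σ_B σ_B(Γ(z))·∂_A Γ_B(z).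 -/

import Mathlib

open Real

/-- Partial derivative in the `A`-th coordinate direction of `ℝ^m = Fin m → ℝ`. -/
noncomputable def pd {m : ℕ} (A : Fin m) (f : (Fin m → ℝ) → ℝ) (p : Fin m → ℝ) : ℝ :=
  fderiv ℝ f p (Pi.single A 1)

/-- The coefficient maps `Θ¹, Θ², Θ³ : V → ℝ^m` of one-forms `Θ^α = Σ_A Θ^α_A dz_A`
satisfy the structure equations of a pseudo-spherical surface in `m` variables:
`dΘ¹ = Θ³ ∧ Θ², dΘ² = Θ¹ ∧ Θ³, dΘ³ = Θ¹ ∧ Θ²`. -/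
def StructEqM {m : ℕ} (V : Set (Fin m → ℝ)) (Θ1 Θ2 Θ3 : (Fin m → ℝ) → Fin m → ℝ) : Prop :=
  ∀ p ∈ V, ∀ A B : Fin m,
    pd A (fun q => Θ1 q B) p - pd B (fun q => Θ1 q A) p
      = Θ3 p A * Θ2 p B - Θ3 p B * Θ2 p A ∧
    pd A (fun q => Θ2 q B) p - pd B (fun q => Θ2 q A) p
      = Θ1 p A * Θ3 p B - Θ1 p B * Θ3 p A ∧
    pd A (fun q => Θ3 q B) p - pd B (fun q => Θ3 q A) p
      = Θ1 p A * Θ2 p B - Θ1 p B * Θ2 p A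

theorem IsCompact.eventually_forall_norm_sub_sub_fderiv_le {X Y : Type*}
    [NormedAddCommGroup X] [NormedSpace ℝ X] [NormedAddCommGroup Y] [NormedSpace ℝ Y]
    {F : X → Y} {K : Set X} (hK : IsCompact K) (hF : ∀ y ∈ K, ContDiffAt ℝ 1 F y)
    {ε : ℝ} (hε : 0 < ε) :
    ∀ᶠ k in nhds (0 : X), ∀ y ∈ K,
      ‖F (y + k) - F y - fderiv ℝ F y k‖ ≤ ε * ‖k‖ ∧ ‖F (y + k) - F y‖ ≤ ε := by
  apply hK.eventually_forall_of_forall_eventually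
  intro y hy
  have hadd : Filter.Tendsto (fun z : X × X => z.2 + z.1) (nhds (0, y)) (nhds y) := by
    have h : Continuous fun z : X × X => z.2 + z.1 := by fun_prop
    simpa using h.tendsto (0, y)
  have hsnd : Filter.Tendsto (fun z : X × X => z.2) (nhds (0, y)) (nhds y) := by
    simpa using continuous_snd.tendsto ((0 : X), y)
  have hstrict := (((hF y hy).hasStrictFDerivAt one_ne_zero).isLittleO.def (half_pos hε))
  have h1 := (hadd.prodMk_nhds hsnd).eventually hstrict
  have hcont : ContinuousAt (fderiv ℝ F) y :=
    (hF y hy).continuousAt_fderiv one_ne_zero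
  have h2 := hsnd.eventually (Metric.tendsto_nhds.1 hcont _ (half_pos hε))
  have hFc := (hF y hy).continuousAt
  have h3 := ((hFc.tendsto.comp hadd).sub (hFc.tendsto.comp hsnd)).norm
  rw [sub_self, norm_zero] at h3
  filter_upwards [h1, h2, h3.eventually (gt_mem_nhds hε)] with z hz1 hz2 hz3
  refine ⟨?_, hz3.le⟩
  simp only [add_sub_cancel_left] at hz1
  rw [dist_eq_norm, norm_sub_rev] at hz2
  have h4 := (fderiv ℝ F y - fderiv ℝ F z.2).le_of_opNorm_le hz2.le z.1
  calc ‖F (z.2 + z.1) - F z.2 - fderiv ℝ F z.2 z.1‖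
      = ‖(F (z.2 + z.1) - F z.2 - fderiv ℝ F y z.1)
          + (fderiv ℝ F y - fderiv ℝ F z.2) z.1‖ := by
        congr 1
        simp only [sub_apply]
        abel
    _ ≤ ε / 2 * ‖z.1‖ + ε / 2 * ‖z.1‖ := (norm_add_le _ _).trans (add_le_add hz1 h4)
    _ = ε * ‖z.1‖ := by ring

section Frobenius

variable {E G : Type*} [NormedAddCommGroup E] [NormedSpace ℝ E]
  [NormedAddCommGroup G] [NormedSpace ℝ G]

/-- Solutions of the ODE obtained by restricting the total differential equation `dθ = F(z, θ)`
to the segment from `p` to `p + x`. -/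
theorem exists_solution_along_segment [CompleteSpace G] {s : Set E} {p x : E}
    {F : E × G → E →L[ℝ] G} {M K : NNReal} (hseg : ∀ t ∈ Set.Icc (0 : ℝ) 1, p + t • x ∈ s)
    (hF : ContinuousOn F (s ×ˢ Set.univ))
    (hM : ∀ z ∈ s, ∀ θ, ‖F (z, θ)‖ ≤ M) (hK : ∀ z ∈ s, LipschitzWith K fun θ => F (z, θ))
    (θ₀ : G) :
    ∃ u : ℝ → G, u 0 = θ₀ ∧ ∀ t ∈ Set.Icc (0 : ℝ) 1,
      HasDerivWithinAt u (F (p + t • x, u t) x) (Set.Icc 0 1) t := by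
  have hPL : IsPicardLindelof (fun t θ => F (p + t • x, θ) x)
      (⟨0, by simp⟩ : Set.Icc (0 : ℝ) 1) θ₀ (M * ‖x‖₊) 0 (M * ‖x‖₊) (K * ‖x‖₊) := by
    constructor
    · intro t ht
      apply LipschitzWith.lipschitzOnWith
      apply LipschitzWith.of_dist_le_mul
      intro a b
      have := (hK _ (hseg t ht)).dist_le_mul a b
      rw [dist_eq_norm] at this ⊢
      rw [← sub_apply]
      calc _ ≤ _ := ContinuousLinearMap.le_of_opNorm_le _ this x
        _ = _ := by push_cast; ring
    · intro θ _
      have : ContinuousOn (fun t : ℝ => F (p + t • x, θ)) (Set.Icc 0 1) :=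
        hF.comp (by fun_prop) fun t ht => ⟨hseg t ht, trivial⟩
      exact this.clm_apply continuousOn_const
    · intro t ht θ _
      simpa using ContinuousLinearMap.le_of_opNorm_le _ (hM _ (hseg t ht) θ) x
    · simp
  obtain ⟨u, hu0, hu⟩ := hPL.exists_eq_forall_mem_Icc_hasDerivWithinAt₀
  exact ⟨u, hu0, hu⟩

/-- Frobenius theorem for the total differential equation `dθ = F(z, θ)` with `F` bounded and
uniformly Lipschitz in `θ`: if the equation is completely integrable, it has a solution on any
open convex set. -/
theorem exists_hasFDerivAt_of_completely_integrable [CompleteSpace G] {s : Set E}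
    (hs : IsOpen s) (hconv : Convex ℝ s) {p : E} (hp : p ∈ s)
    {F : E × G → E →L[ℝ] G} {M K : NNReal}
    (hF : ContDiffOn ℝ 1 F (s ×ˢ Set.univ))
    (hM : ∀ z ∈ s, ∀ θ, ‖F (z, θ)‖ ≤ M) (hK : ∀ z ∈ s, LipschitzWith K fun θ => F (z, θ))
    (hint : ∀ z ∈ s, ∀ θ v w,
      fderiv ℝ F (z, θ) (v, F (z, θ) v) w = fderiv ℝ F (z, θ) (w, F (z, θ) w) v)
    (θ₀ : G) :
    ∃ θ : E → G, ∀ z ∈ s, HasFDerivAt θ (F (z, θ z)) z := by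
  have hseg : ∀ z ∈ s, ∀ t ∈ Set.Icc (0 : ℝ) 1, p + t • (z - p) ∈ s := fun z hz t ht =>
    hconv.add_smul_sub_mem hp hz ht
  have hsol : ∀ z, ∃ u : ℝ → G, z ∈ s → u 0 = θ₀ ∧ ∀ t ∈ Set.Icc (0 : ℝ) 1,
      HasDerivWithinAt u (F (p + t • (z - p), u t) (z - p)) (Set.Icc 0 1) t := by
    intro z
    by_cases hz : z ∈ s
    · obtain ⟨u, hu⟩ := exists_solution_along_segment (hseg z hz) hF.continuousOn hM hK θ₀
      exact ⟨u, fun _ => hu⟩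
    · exact ⟨0, fun h => absurd h hz⟩
  choose u hu using hsol
  have hcd : ∀ z ∈ s, ∀ θ, ContDiffAt ℝ 1 F (z, θ) := fun z hz θ =>
    hF.contDiffAt ((hs.prod isOpen_univ).mem_nhds ⟨hz, trivial⟩)
  refine ⟨fun z => u z 1, fun z hz => ?_⟩
  obtain ⟨hu0, hu1⟩ := hu z hz
  set x := z - p with hx
  have hzx : p + x = z := by simp [hx]
  have hucont : ContinuousOn (u z) (Set.Icc 0 1) := fun t ht => (hu1 t ht).continuousWithinAt
  set Y : ℝ → E × G := fun t => (p + t • x, u z t) with hY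
  have hYK : IsCompact (Y '' Set.Icc 0 1) :=
    isCompact_Icc.image_of_continuousOn (by fun_prop)
  set L : ℝ := K * (‖x‖ + 1) + 1 with hL
  have hLpos : 0 < L := by positivity
  set c : ℝ := (exp L - 1) / L with hc
  have hcpos : 0 < c := div_pos (by linarith [add_one_lt_exp hLpos.ne']) hLpos
  set C : ℝ := 1 + M with hC
  have hCpos : 0 < C := by positivity
  rw [hasFDerivAt_iff_isLittleO_nhds_zero, Asymptotics.isLittleO_iff]
  intro ε hε
  set ε₁ : ℝ := ε / ((C * ‖x‖ + 1) * c) with hε₁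
  have hε₁pos : 0 < ε₁ := by positivity
  have hunif := hYK.eventually_forall_norm_sub_sub_fderiv_le (F := F) (ε := ε₁)
    (by rintro _ ⟨t, ht, rfl⟩; exact hcd _ (hseg z hz t ht) _) hε₁pos
  obtain ⟨δ, hδ, hunif⟩ := Metric.eventually_nhds_iff.1 hunif
  have hmem : ∀ᶠ h in nhds (0 : E), z + h ∈ s :=
    (show Continuous fun h : E => z + h by fun_prop).continuousAt.eventually
      (by simpa using hs.mem_nhds hz)
  have hsmall : ∀ᶠ h in nhds (0 : E), ‖h‖ < min 1 (δ / C) := by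
    filter_upwards [Metric.ball_mem_nhds (0 : E) (show 0 < min 1 (δ / C) by positivity)] with h hh
    simpa using hh
  filter_upwards [hmem, hsmall] with h hzh hh
  have hh1 : ‖h‖ ≤ 1 := hh.le.trans (min_le_left _ _)
  have hhδ : C * ‖h‖ < δ := by
    have := hh.trans_le (min_le_right _ _)
    rwa [lt_div_iff₀ hCpos, mul_comm] at this
  obtain ⟨hv0, hv1⟩ := hu (z + h) hzh
  have hxh : z + h - p = x + h := by rw [hx]; abel
  have hsegh := hseg (z + h) hzh
  rw [hxh] at hv1 hsegh
  have hw : ∀ t ∈ Set.Icc (0 : ℝ) 1,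
      HasDerivWithinAt (fun t => u z t + t • F (Y t) h)
        (F (Y t) x + ((1 : ℝ) • F (Y t) h + t • fderiv ℝ F (Y t) (x, F (Y t) x) h))
        (Set.Icc 0 1) t := by
    intro t ht
    have hYd : HasDerivWithinAt Y (x, F (Y t) x) (Set.Icc 0 1) t := by
      refine HasDerivWithinAt.prodMk ?_ (hu1 t ht)
      simpa using (((hasDerivAt_id t).smul_const x).const_add p).hasDerivWithinAt
    have hFd := ((hcd _ (hseg z hz t ht) (u z t)).differentiableAt
      one_ne_zero).hasFDerivAt.comp_hasDerivWithinAt t hYd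
    have hFh := hFd.clm_apply (hasDerivWithinAt_const t (Set.Icc (0:ℝ) 1) h)
    have := (hu1 t ht).add ((hasDerivWithinAt_id t (Set.Icc (0:ℝ) 1)).smul hFh)
    refine this.congr_deriv ?_
    simp [hY, hx, add_comm]
  have hIci : ∀ {f : ℝ → G} {f' : G} {t : ℝ}, t ∈ Set.Ico (0 : ℝ) 1 →
      HasDerivWithinAt f f' (Set.Icc 0 1) t → HasDerivWithinAt f f' (Set.Ici t) t := by
    intro f f' t ht hf
    exact (hf.mono (Set.Icc_subset_Icc_left ht.1)).mono_of_mem_nhdsWithin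
      (Icc_mem_nhdsGE ht.2)
  have hgron := dist_le_of_approx_trajectories_ODE_of_mem (E := G)
    (v := fun t θ => F (p + t • (x + h), θ) (x + h)) (s := fun _ => Set.univ)
    (K := K * (‖x‖₊ + 1) + 1) (a := 0) (b := 1) (δ := 0) (εf := 0)
    (εg := ε₁ * (C * ‖x‖ + 1) * ‖h‖)
    (f := u (z + h)) (g := fun t => u z t + t • F (Y t) h)
    (f' := fun t => F (p + t • (x + h), u (z + h) t) (x + h))
    (g' := fun t => F (Y t) x + ((1 : ℝ) • F (Y t) h + t • fderiv ℝ F (Y t) (x, F (Y t) x) h))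
    ?_ (fun t ht => (hv1 t ht).continuousWithinAt)
    (fun t ht => hIci ht (hv1 t (Set.Ico_subset_Icc_self ht))) (by simp) (by simp)
    (fun t ht => (hw t ht).continuousWithinAt)
    (fun t ht => hIci ht (hw t (Set.Ico_subset_Icc_self ht))) ?_ (by simp)
    (by simp [hv0, hu0]) 1 (by simp)
  · rw [dist_eq_norm, gronwallBound_of_K_ne_0 (by positivity)] at hgron
    simp only [hY, one_smul, hzx, zero_add, zero_mul, sub_zero, mul_one] at hgron
    have hLc : ((K * (‖x‖₊ + 1) + 1 : NNReal) : ℝ) = L := by push_cast; rfl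
    rw [hLc] at hgron
    rw [sub_sub]
    refine hgron.trans (le_of_eq ?_)
    rw [hε₁]
    field_simp
    rw [hc]
    field_simp
  · intro t ht
    apply LipschitzWith.lipschitzOnWith
    apply LipschitzWith.of_dist_le_mul
    intro a b
    have h1 := (hK _ (hsegh t (Set.Ico_subset_Icc_self ht))).dist_le_mul a b
    rw [dist_eq_norm] at h1 ⊢
    rw [← sub_apply]
    refine (ContinuousLinearMap.le_of_opNorm_le _ h1 _).trans ?_
    have h2 : ‖x + h‖ ≤ ‖x‖ + 1 := (norm_add_le _ _).trans (by linarith)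
    push_cast
    calc K * dist a b * ‖x + h‖ ≤ K * dist a b * (‖x‖ + 1) := by gcongr
      _ ≤ _ := by nlinarith [dist_nonneg (x := a) (y := b)]
  · intro t ht
    have ht' := Set.Ico_subset_Icc_self ht
    set k : E × G := (t • h, t • F (Y t) h) with hk
    have hk_norm : ‖k‖ ≤ C * ‖h‖ := by
      have hFh : ‖F (Y t) h‖ ≤ M * ‖h‖ :=
        ContinuousLinearMap.le_of_opNorm_le _ (hM _ (hseg z hz t ht') _) h
      have habs : |t| ≤ 1 := by rw [abs_of_nonneg ht.1]; exact ht.2.le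
      rw [hk, Prod.norm_def, norm_smul, norm_smul, Real.norm_eq_abs, hC]
      apply max_le
      · nlinarith [norm_nonneg h, mul_nonneg M.2 (norm_nonneg h),
          mul_le_of_le_one_left (norm_nonneg h) habs]
      · nlinarith [norm_nonneg h, mul_le_of_le_one_left (norm_nonneg (F (Y t) h)) habs]
    obtain ⟨hA, hB⟩ := hunif (y := k) (by rw [dist_zero_right]; exact hk_norm.trans_lt hhδ)
      (Y t) (Set.mem_image_of_mem _ ht')
    have hYk : (p + t • (x + h), u z t + t • F (Y t) h) = Y t + k := by
      simp [hY, hk, smul_add, add_assoc]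
    have hsymm : t • fderiv ℝ F (Y t) (x, F (Y t) x) h = fderiv ℝ F (Y t) k x := by
      rw [show k = t • (h, F (Y t) h) from rfl, map_smul, smul_apply,
        hint _ (hseg z hz t ht') (u z t)]
    rw [dist_eq_norm, hYk, hsymm]
    calc _ = ‖(F (Y t + k) - F (Y t) - fderiv ℝ F (Y t) k) x + (F (Y t + k) - F (Y t)) h‖ := by
          rw [← norm_neg]
          congr 1
          simp only [sub_apply, map_add, one_smul]
          abel
      _ ≤ ε₁ * ‖k‖ * ‖x‖ + ε₁ * ‖h‖ := (norm_add_le _ _).trans (add_le_add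
          (ContinuousLinearMap.le_of_opNorm_le _ hA _) (ContinuousLinearMap.le_of_opNorm_le _ hB _))
      _ ≤ ε₁ * (C * ‖h‖) * ‖x‖ + ε₁ * ‖h‖ := by gcongr
      _ = _ := by ring

theorem contDiffOn_infty_of_hasFDerivAt {s : Set E} (hs : IsOpen s) {F : E × G → E →L[ℝ] G}
    (hF : ContDiffOn ℝ (⊤ : ℕ∞) F (s ×ˢ Set.univ)) {θ : E → G}
    (hθ : ∀ z ∈ s, HasFDerivAt θ (F (z, θ z)) z) : ContDiffOn ℝ (⊤ : ℕ∞) θ s := by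
  rw [contDiffOn_infty]
  intro n
  induction n with
  | zero =>
    exact contDiffOn_zero.2 fun z hz => (hθ z hz).continuousAt.continuousWithinAt
  | succ n ih =>
    push_cast
    rw [contDiffOn_succ_iff_fderiv_of_isOpen hs]
    refine ⟨fun z hz => (hθ z hz).differentiableAt.differentiableWithinAt, by simp, ?_⟩
    have h := (contDiffOn_infty.1 hF n).comp (contDiffOn_id.prodMk ih)
      (fun z hz => (⟨hz, trivial⟩ : (z, θ z) ∈ s ×ˢ Set.univ))
    exact h.congr fun z hz => (hθ z hz).fderiv

end Frobenius

/-- The one-form with coefficient vector `a`, i.e. `v ↦ ∑ A, a A * v A`. -/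
noncomputable def coeffForm (m : ℕ) : (Fin m → ℝ) →L[ℝ] (Fin m → ℝ) →L[ℝ] ℝ :=
  ∑ A : Fin m, (ContinuousLinearMap.proj (R := ℝ) (φ := fun _ : Fin m => ℝ) A).smulRight
    (ContinuousLinearMap.proj (R := ℝ) (φ := fun _ : Fin m => ℝ) A)

theorem coeffForm_apply {m : ℕ} (a v : Fin m → ℝ) : coeffForm m a v = ∑ A, a A * v A := by
  simp [coeffForm]

theorem coeffForm_single {m : ℕ} (a : Fin m → ℝ) (A : Fin m) :
    coeffForm m a (Pi.single A 1) = a A := by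
  simp [coeffForm_apply, Pi.single_apply]

theorem pd_eq_of_hasFDerivAt {m : ℕ} {f : (Fin m → ℝ) → ℝ} {f' : (Fin m → ℝ) →L[ℝ] ℝ}
    {q : Fin m → ℝ} (hf : HasFDerivAt f f' q) (A : Fin m) : pd A f q = f' (Pi.single A 1) := by
  rw [pd, hf.fderiv]

/-- A bilinear form whose antisymmetrization agrees with `a ∧ b` on coordinate vectors agrees with
it everywhere. -/
theorem coeffForm_sub_eq_wedge {m : ℕ} {D : (Fin m → ℝ) →L[ℝ] Fin m → ℝ} {a b : Fin m → ℝ}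
    (h : ∀ A B, D (Pi.single A 1) B - D (Pi.single B 1) A = a A * b B - a B * b A)
    (v w : Fin m → ℝ) :
    coeffForm m (D v) w - coeffForm m (D w) v =
      coeffForm m a v * coeffForm m b w - coeffForm m a w * coeffForm m b v := by
  have hD : ∀ v w, coeffForm m (D v) w = ∑ A, ∑ B, v A * w B * D (Pi.single A 1) B := by
    intro v w
    have hv : D v = ∑ A, v A • D (Pi.single A 1) := by
      conv_lhs => rw [pi_eq_sum_univ' v]
      simp [map_sum, map_smul]
    rw [coeffForm_apply, Finset.sum_comm]
    refine Finset.sum_congr rfl fun B _ => ?_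
    rw [hv, Finset.sum_apply, Finset.sum_mul]
    refine Finset.sum_congr rfl fun A _ => ?_
    simp only [Pi.smul_apply, smul_eq_mul]
    ring
  rw [hD v w, hD w v, Finset.sum_comm (f := fun A B => w A * v B * D (Pi.single A 1) B)]
  simp only [coeffForm_apply, Finset.sum_mul_sum]
  rw [Finset.sum_comm (f := fun i j => a i * w i * (b j * v j))]
  simp only [← Finset.sum_sub_distrib]
  refine Finset.sum_congr rfl fun A _ => Finset.sum_congr rfl fun B _ => ?_
  linear_combination v A * w B * h A B

section PseudoSpherical

variable {m : ℕ} {V : Set (Fin m → ℝ)}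

theorem pd_coeff {Θ : (Fin m → ℝ) → Fin m → ℝ} {z : Fin m → ℝ} (h : DifferentiableAt ℝ Θ z)
    (A B : Fin m) : pd A (fun q => Θ q B) z = fderiv ℝ Θ z (Pi.single A 1) B := by
  rw [pd_eq_of_hasFDerivAt (hasFDerivAt_pi'.1 h.hasFDerivAt B)]
  rfl

/-- The total differential equation `dθ = Θ¹ cos θ + Θ² sin θ - Θ³` for the rotation angle which
makes the first and the third rotated forms agree has a local smooth solution. -/
theorem exists_rotation_angle {Θ1 Θ2 Θ3 : (Fin m → ℝ) → Fin m → ℝ} (hV : IsOpen V)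
    (hΘ1 : ContDiffOn ℝ (⊤ : ℕ∞) Θ1 V) (hΘ2 : ContDiffOn ℝ (⊤ : ℕ∞) Θ2 V)
    (hΘ3 : ContDiffOn ℝ (⊤ : ℕ∞) Θ3 V) (hstruct : StructEqM V Θ1 Θ2 Θ3)
    {p : Fin m → ℝ} (hp : p ∈ V) :
    ∃ (U : Set (Fin m → ℝ)) (θ : (Fin m → ℝ) → ℝ), IsOpen U ∧ Convex ℝ U ∧ p ∈ U ∧ U ⊆ V ∧
      ContDiffOn ℝ (⊤ : ℕ∞) θ U ∧ ∀ z ∈ U, HasFDerivAt θ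
        (cos (θ z) • coeffForm m (Θ1 z) + sin (θ z) • coeffForm m (Θ2 z) - coeffForm m (Θ3 z))
        z := by
  have hform : ∀ {Θ : (Fin m → ℝ) → Fin m → ℝ}, ContDiffOn ℝ (⊤ : ℕ∞) Θ V →
      ContDiffOn ℝ (⊤ : ℕ∞) (fun z => coeffForm m (Θ z)) V := fun h =>
    (coeffForm m).contDiff.comp_contDiffOn h
  have hbound : ∀ {Θ : (Fin m → ℝ) → Fin m → ℝ}, ContDiffOn ℝ (⊤ : ℕ∞) Θ V →
      ∃ R : NNReal, ∀ᶠ z in nhds p, ‖coeffForm m (Θ z)‖ ≤ R := by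
    intro Θ h
    have hc := ((hform h).continuousOn.continuousAt (hV.mem_nhds hp)).norm
    refine ⟨‖coeffForm m (Θ p)‖₊ + 1, ?_⟩
    filter_upwards [hc.eventually (gt_mem_nhds (lt_add_one ‖coeffForm m (Θ p)‖))] with z hz
    exact hz.le
  obtain ⟨R1, hR1⟩ := hbound hΘ1
  obtain ⟨R2, hR2⟩ := hbound hΘ2
  obtain ⟨R3, hR3⟩ := hbound hΘ3
  obtain ⟨r, hr, hball⟩ := Metric.eventually_nhds_iff_ball.1
    (((hR1.and hR2).and hR3).and (hV.mem_nhds hp))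
  set U := Metric.ball p r
  have hUV : U ⊆ V := fun z hz => (hball z hz).2
  set F : (Fin m → ℝ) × ℝ → (Fin m → ℝ) →L[ℝ] ℝ := fun y =>
    cos y.2 • coeffForm m (Θ1 y.1) + sin y.2 • coeffForm m (Θ2 y.1) - coeffForm m (Θ3 y.1) with hF
  have hfst : Set.MapsTo Prod.fst (U ×ˢ (Set.univ : Set ℝ)) V := fun y hy => hUV hy.1
  have hFsmooth : ContDiffOn ℝ (⊤ : ℕ∞) F (U ×ˢ Set.univ) :=
    (((contDiff_cos.comp contDiff_snd).contDiffOn.smul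
      ((hform hΘ1).comp contDiffOn_fst hfst)).add
      ((contDiff_sin.comp contDiff_snd).contDiffOn.smul
      ((hform hΘ2).comp contDiffOn_fst hfst))).sub ((hform hΘ3).comp contDiffOn_fst hfst)
  have hM : ∀ z ∈ U, ∀ θ, ‖F (z, θ)‖ ≤ (R1 + R2 + R3 : NNReal) := by
    intro z hz θ
    obtain ⟨⟨⟨h1, h2⟩, h3⟩, -⟩ := hball z hz
    push_cast
    refine (norm_sub_le _ _).trans (add_le_add ((norm_add_le _ _).trans (add_le_add ?_ ?_)) h3)
    · rw [norm_smul]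
      exact (mul_le_of_le_one_left (norm_nonneg _) (abs_cos_le_one θ)).trans h1
    · rw [norm_smul]
      exact (mul_le_of_le_one_left (norm_nonneg _) (abs_sin_le_one θ)).trans h2
  have hK : ∀ z ∈ U, LipschitzWith (R1 + R2) fun θ => F (z, θ) := by
    intro z hz
    obtain ⟨⟨⟨h1, h2⟩, -⟩, -⟩ := hball z hz
    apply LipschitzWith.of_dist_le_mul
    intro a b
    have : F (z, a) - F (z, b) = (cos a - cos b) • coeffForm m (Θ1 z)
        + (sin a - sin b) • coeffForm m (Θ2 z) := by
      simp only [hF]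
      module
    rw [dist_eq_norm, this, Real.dist_eq]
    refine (norm_add_le _ _).trans ?_
    rw [norm_smul, norm_smul]
    push_cast
    rw [add_mul, mul_comm (R1 : ℝ), mul_comm (R2 : ℝ)]
    gcongr
    · exact abs_cos_sub_cos_le a b
    · exact abs_sin_sub_sin_le a b
  have hint : ∀ z ∈ U, ∀ θ v w,
      fderiv ℝ F (z, θ) (v, F (z, θ) v) w = fderiv ℝ F (z, θ) (w, F (z, θ) w) v := by
    intro z hz θ v w
    have hd : ∀ {Θ : (Fin m → ℝ) → Fin m → ℝ}, ContDiffOn ℝ (⊤ : ℕ∞) Θ V →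
        DifferentiableAt ℝ Θ z := fun h =>
      (h.contDiffAt (hV.mem_nhds (hUV hz))).differentiableAt (by simp)
    have hd' : ∀ {Θ : (Fin m → ℝ) → Fin m → ℝ}, ContDiffOn ℝ (⊤ : ℕ∞) Θ V →
        HasFDerivAt (fun y : (Fin m → ℝ) × ℝ => coeffForm m (Θ y.1))
          (((coeffForm m).comp (fderiv ℝ Θ z)).comp (ContinuousLinearMap.fst ℝ _ ℝ)) (z, θ) :=
      fun {Θ} h => HasFDerivAt.comp (g := fun z => coeffForm m (Θ z)) (f := Prod.fst) (z, θ)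
        ((coeffForm m).hasFDerivAt.comp z (hd h).hasFDerivAt) hasFDerivAt_fst
    have hFd := (((hasFDerivAt_snd (𝕜 := ℝ) (p := (z, θ))).cos.smul (hd' hΘ1)).add
      ((hasFDerivAt_snd (𝕜 := ℝ) (p := (z, θ))).sin.smul (hd' hΘ2))).sub (hd' hΘ3)
    have hval : ∀ v τ w, fderiv ℝ F (z, θ) (v, τ) w =
        cos θ * coeffForm m (fderiv ℝ Θ1 z v) w + sin θ * coeffForm m (fderiv ℝ Θ2 z v) w
          - coeffForm m (fderiv ℝ Θ3 z v) w
          + τ * (-sin θ * coeffForm m (Θ1 z) w + cos θ * coeffForm m (Θ2 z) w) := by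
      intro v τ w
      have h : fderiv ℝ F (z, θ) = _ := hFd.fderiv
      rw [h]
      simp
      ring
    have hs := fun A B => hstruct z (hUV hz) A B
    simp only [pd_coeff (hd hΘ1), pd_coeff (hd hΘ2), pd_coeff (hd hΘ3)] at hs
    have e1 := coeffForm_sub_eq_wedge (fun A B => (hs A B).1) v w
    have e2 := coeffForm_sub_eq_wedge (fun A B => (hs A B).2.1) v w
    have e3 := coeffForm_sub_eq_wedge (fun A B => (hs A B).2.2) v w
    rw [hval, hval]
    simp only [hF, sub_apply, add_apply, smul_apply, smul_eq_mul]
    linear_combination cos θ * e1 + sin θ * e2 - e3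
      + (coeffForm m (Θ1 z) v * coeffForm m (Θ2 z) w
        - coeffForm m (Θ1 z) w * coeffForm m (Θ2 z) v) * sin_sq_add_cos_sq θ
  obtain ⟨θ, hθ⟩ := exists_hasFDerivAt_of_completely_integrable Metric.isOpen_ball
    (convex_ball p r) (Metric.mem_ball_self hr) (hFsmooth.of_le (by simp)) hM hK hint 0
  exact ⟨U, θ, Metric.isOpen_ball, convex_ball p r, Metric.mem_ball_self hr, hUV,
    contDiffOn_infty_of_hasFDerivAt Metric.isOpen_ball hFsmooth hθ, hθ⟩

/-- A smooth closed one-form on an open convex set has a smooth primitive. -/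
theorem exists_contDiffOn_primitive {E : Type*} [NormedAddCommGroup E] [NormedSpace ℝ E]
    {U : Set E} (hU : IsOpen U) (hconv : Convex ℝ U) {ω : E → E →L[ℝ] ℝ}
    (hω : ContDiffOn ℝ (⊤ : ℕ∞) ω U)
    (hdω : ∀ z ∈ U, ∀ v w, fderiv ℝ ω z v w = fderiv ℝ ω z w v) :
    ∃ f : E → ℝ, ContDiffOn ℝ (⊤ : ℕ∞) f U ∧ ∀ z ∈ U, HasFDerivAt f (ω z) z := by
  obtain ⟨f, hf⟩ := hconv.exists_forall_hasFDerivAt_of_fderiv_symmetric hU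
    (hω.differentiableOn (by simp)) hdω
  exact ⟨f, contDiffOn_infty_of_hasFDerivAt (F := fun y => ω y.1) hU
    (hω.comp contDiffOn_fst fun y hy => hy.1) hf, hf⟩

/-- After rotating a pseudo-spherical coframe so that its first and third forms agree, the second
form is `d log β` and `β` times the first form is exact. -/
theorem exists_rotated_potentials {Θ1 Θ2 Θ3 : (Fin m → ℝ) → Fin m → ℝ} (hV : IsOpen V)
    (hΘ1 : ContDiffOn ℝ (⊤ : ℕ∞) Θ1 V) (hΘ2 : ContDiffOn ℝ (⊤ : ℕ∞) Θ2 V)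
    (hΘ3 : ContDiffOn ℝ (⊤ : ℕ∞) Θ3 V) (hstruct : StructEqM V Θ1 Θ2 Θ3)
    {p : Fin m → ℝ} (hp : p ∈ V) :
    ∃ (U : Set (Fin m → ℝ)) (θ a β : (Fin m → ℝ) → ℝ), IsOpen U ∧ p ∈ U ∧ U ⊆ V ∧
      ContDiffOn ℝ (⊤ : ℕ∞) θ U ∧ ContDiffOn ℝ (⊤ : ℕ∞) a U ∧ ContDiffOn ℝ (⊤ : ℕ∞) β U ∧
      (∀ z, 0 < β z) ∧ ∀ z ∈ U,
        HasFDerivAt θ (cos (θ z) • coeffForm m (Θ1 z) + sin (θ z) • coeffForm m (Θ2 z)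
          - coeffForm m (Θ3 z)) z ∧
        HasFDerivAt a (β z • (cos (θ z) • coeffForm m (Θ1 z) + sin (θ z) • coeffForm m (Θ2 z))) z ∧
        HasFDerivAt β
          (β z • (cos (θ z) • coeffForm m (Θ2 z) - sin (θ z) • coeffForm m (Θ1 z))) z := by
  obtain ⟨U, θ, hU, hconv, hpU, hUV, hθ, hdθ⟩ :=
    exists_rotation_angle hV hΘ1 hΘ2 hΘ3 hstruct hp
  have hform : ∀ {Θ : (Fin m → ℝ) → Fin m → ℝ}, ContDiffOn ℝ (⊤ : ℕ∞) Θ V →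
      ContDiffOn ℝ (⊤ : ℕ∞) (fun z => coeffForm m (Θ z)) U := fun h =>
    (coeffForm m).contDiff.comp_contDiffOn (h.mono hUV)
  have hd : ∀ {Θ : (Fin m → ℝ) → Fin m → ℝ}, ContDiffOn ℝ (⊤ : ℕ∞) Θ V → ∀ z ∈ U,
      DifferentiableAt ℝ Θ z := fun h z hz =>
    (h.contDiffAt (hV.mem_nhds (hUV hz))).differentiableAt (by simp)
  have hd' : ∀ {Θ : (Fin m → ℝ) → Fin m → ℝ}, ContDiffOn ℝ (⊤ : ℕ∞) Θ V → ∀ z ∈ U,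
      HasFDerivAt (fun y => coeffForm m (Θ y)) ((coeffForm m).comp (fderiv ℝ Θ z)) z :=
    fun h z hz => (coeffForm m).hasFDerivAt.comp z (hd h z hz).hasFDerivAt
  have hcos := contDiff_cos.comp_contDiffOn hθ
  have hsin := contDiff_sin.comp_contDiffOn hθ
  have hwedge : ∀ z ∈ U, ∀ v w, _ ∧ _ := fun z hz v w =>
    have hs := fun A B => hstruct z (hUV hz) A B
    have hs1 : ∀ A B, _ := fun A B => by
      have := (hs A B).1
      rwa [pd_coeff (hd hΘ1 z hz), pd_coeff (hd hΘ1 z hz)] at this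
    have hs2 : ∀ A B, _ := fun A B => by
      have := (hs A B).2.1
      rwa [pd_coeff (hd hΘ2 z hz), pd_coeff (hd hΘ2 z hz)] at this
    And.intro (coeffForm_sub_eq_wedge hs1 v w) (coeffForm_sub_eq_wedge hs2 v w)
  obtain ⟨g, hg, hdg⟩ := exists_contDiffOn_primitive hU hconv
    ((hcos.smul (hform hΘ2)).sub (hsin.smul (hform hΘ1))) (by
      intro z hz v w
      have h := ((hdθ z hz).cos.smul (hd' hΘ2 z hz)).sub ((hdθ z hz).sin.smul (hd' hΘ1 z hz))
      have h' := h.fderiv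
      obtain ⟨e1, e2⟩ := hwedge z hz v w
      refine (congrArg (fun D => D v w) h').trans (Eq.trans ?_ (congrArg (fun D => D w v) h').symm)
      simp
      linear_combination cos (θ z) * e2 - sin (θ z) * e1)
  have hdβ : ∀ z ∈ U, HasFDerivAt (fun z => exp (g z))
      (exp (g z) • (cos (θ z) • coeffForm m (Θ2 z) - sin (θ z) • coeffForm m (Θ1 z))) z :=
    fun z hz => (hdg z hz).exp
  have hβ := contDiff_exp.comp_contDiffOn hg
  obtain ⟨a, ha, hda⟩ := exists_contDiffOn_primitive hU hconv
    (hβ.smul ((hcos.smul (hform hΘ1)).add (hsin.smul (hform hΘ2)))) (by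
      intro z hz v w
      have h := (hdβ z hz).smul
        (((hdθ z hz).cos.smul (hd' hΘ1 z hz)).add ((hdθ z hz).sin.smul (hd' hΘ2 z hz)))
      have h' := h.fderiv
      obtain ⟨e1, e2⟩ := hwedge z hz v w
      refine (congrArg (fun D => D v w) h').trans (Eq.trans ?_ (congrArg (fun D => D w v) h').symm)
      simp
      linear_combination exp (g z) * (cos (θ z) * e1 + sin (θ z) * e2))
  exact ⟨U, θ, a, fun z => exp (g z), hU, hpU, hUV, hθ, ha, hβ, fun z => exp_pos _,
    fun z hz => ⟨hdθ z hz, hda z hz, hdβ z hz⟩⟩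

end PseudoSpherical

/-- a pseudo-spherical coframe in `m` variables satisfying the genericity
condition `Θ¹₀Θ²₁ − Θ¹₁Θ²₀ ≠ 0` can locally be obtained by "dressing" the hyperbolic
coframe `σ¹ = σ³ = (dx̂ + Σ dτ̂ᵢ)/t̂`, `σ² = dt̂/t̂` of the Poincaré half-space: there are
local maps `Γ = (α, β, τ₁, …)` with nonvanishing Jacobian and a rotation angle `θ` with
`Γ*σ¹ = Θ¹ cos θ + Θ² sin θ`, `Γ*σ² = −Θ¹ sin θ + Θ² cos θ`, `Γ*σ³ = Θ³ + dθ`. -/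
theorem dressing_of_poincare_coframe
    (m : ℕ) (hm : 2 ≤ m)
    (V : Set (Fin m → ℝ)) (hV : IsOpen V)
    (Θ1 Θ2 Θ3 : (Fin m → ℝ) → Fin m → ℝ)
    (hΘ1 : ContDiffOn ℝ (⊤ : ℕ∞) Θ1 V) (hΘ2 : ContDiffOn ℝ (⊤ : ℕ∞) Θ2 V) (hΘ3 : ContDiffOn ℝ (⊤ : ℕ∞) Θ3 V)
    (hstruct : StructEqM V Θ1 Θ2 Θ3)
    (hgen : ∀ p ∈ V,
      Θ1 p ⟨0, by omega⟩ * Θ2 p ⟨1, by omega⟩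
        - Θ1 p ⟨1, by omega⟩ * Θ2 p ⟨0, by omega⟩ ≠ 0)
    -- the hyperbolic coframe on the half-space `{t̂ > 0}`:
    (σ1 σ2 σ3 : (Fin m → ℝ) → Fin m → ℝ)
    (hσ1 : ∀ w : Fin m → ℝ, ∀ A : Fin m,
      σ1 w A = if (A : ℕ) = 1 then 0 else 1 / w ⟨1, by omega⟩)
    (hσ2 : ∀ w : Fin m → ℝ, ∀ A : Fin m,
      σ2 w A = if (A : ℕ) = 1 then 1 / w ⟨1, by omega⟩ else 0)
    (hσ3 : σ3 = σ1) :
    ∀ p ∈ V,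
      ∃ (U : Set (Fin m → ℝ)) (θ α β : (Fin m → ℝ) → ℝ)
        (Γ : (Fin m → ℝ) → (Fin m → ℝ)),
        IsOpen U ∧ p ∈ U ∧ U ⊆ V ∧
        ContDiffOn ℝ (⊤ : ℕ∞) θ U ∧ ContDiffOn ℝ (⊤ : ℕ∞) α U ∧ ContDiffOn ℝ (⊤ : ℕ∞) β U ∧
        (∀ q ∈ U, 0 < β q) ∧
        (∀ z : Fin m → ℝ,
          Γ z ⟨0, by omega⟩ = α z ∧ Γ z ⟨1, by omega⟩ = β z ∧
          ∀ A : Fin m, 2 ≤ (A : ℕ) → Γ z A = z A) ∧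
        (∀ q ∈ U,
          (Matrix.of fun A B : Fin m => pd A (fun z => Γ z B) q).det ≠ 0) ∧
        (∀ q ∈ U, ∀ A : Fin m,
          (∑ B : Fin m, σ1 (Γ q) B * pd A (fun z => Γ z B) q)
            = Θ1 q A * Real.cos (θ q) + Θ2 q A * Real.sin (θ q) ∧
          (∑ B : Fin m, σ2 (Γ q) B * pd A (fun z => Γ z B) q)
            = -Θ1 q A * Real.sin (θ q) + Θ2 q A * Real.cos (θ q) ∧
          (∑ B : Fin m, σ3 (Γ q) B * pd A (fun z => Γ z B) q)
            = Θ3 q A + pd A θ q) := by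
  obtain ⟨n, rfl⟩ : ∃ n, m = n + 2 := ⟨m - 2, by omega⟩
  intro p hp
  obtain ⟨U, θ, a, β, hU, hpU, hUV, hθ, ha, hβ, hβpos, hder⟩ :=
    exists_rotated_potentials hV hΘ1 hΘ2 hΘ3 hstruct hp
  set S : (Fin (n + 2) → ℝ) →L[ℝ] ℝ :=
    ∑ i : Fin n, ContinuousLinearMap.proj (R := ℝ) (φ := fun _ : Fin (n + 2) => ℝ) i.succ.succ
    with hS
  set α : (Fin (n + 2) → ℝ) → ℝ := fun z => a z - S z
  set Γ : (Fin (n + 2) → ℝ) → Fin (n + 2) → ℝ := fun z =>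
    Fin.cons (α z) (Fin.cons (β z) fun i => z i.succ.succ)
  have hone : (⟨1, by omega⟩ : Fin (n + 2)) = Fin.succ 0 := rfl
  have hΓ1 : ∀ z, Γ z (Fin.succ 0) = β z := fun z => rfl
  have hpα : ∀ q ∈ U, ∀ A, pd A (fun z => Γ z 0) q =
      β q * (cos (θ q) * Θ1 q A + sin (θ q) * Θ2 q A) - S (Pi.single A 1) := by
    intro q hq A
    rw [pd_eq_of_hasFDerivAt (f := fun z => Γ z 0) ((hder q hq).2.1.sub S.hasFDerivAt) A]
    simp [coeffForm_single, mul_add]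
  have hpβ : ∀ q ∈ U, ∀ A, pd A (fun z => Γ z (Fin.succ 0)) q =
      β q * (cos (θ q) * Θ2 q A - sin (θ q) * Θ1 q A) := by
    intro q hq A
    rw [pd_eq_of_hasFDerivAt (f := fun z => Γ z (Fin.succ 0)) (hder q hq).2.2 A]
    simp [coeffForm_single]
  have hpz : ∀ q A (i : Fin n), pd A (fun z => Γ z i.succ.succ) q =
      (Pi.single A 1 : Fin (n + 2) → ℝ) i.succ.succ := by
    intro q A i
    exact pd_eq_of_hasFDerivAt (hasFDerivAt_apply (𝕜 := ℝ) i.succ.succ q) A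
  have hpθ : ∀ q ∈ U, ∀ A, pd A θ q =
      cos (θ q) * Θ1 q A + sin (θ q) * Θ2 q A - Θ3 q A := by
    intro q hq A
    rw [pd_eq_of_hasFDerivAt (hder q hq).1 A]
    simp [coeffForm_single]
  have hpull1 : ∀ q ∈ U, ∀ A, ∑ B, σ1 (Γ q) B * pd A (fun z => Γ z B) q =
      cos (θ q) * Θ1 q A + sin (θ q) * Θ2 q A := by
    intro q hq A
    have hβq := (hβpos q).ne'
    rw [Fin.sum_univ_succ, Fin.sum_univ_succ]
    simp only [hpα q hq, hpz, hσ1, hone, hΓ1]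
    simp [← Finset.mul_sum, hS]
    field_simp
    ring
  have hpull2 : ∀ q ∈ U, ∀ A, ∑ B, σ2 (Γ q) B * pd A (fun z => Γ z B) q =
      cos (θ q) * Θ2 q A - sin (θ q) * Θ1 q A := by
    intro q hq A
    have hβq := (hβpos q).ne'
    rw [Fin.sum_univ_succ, Fin.sum_univ_succ]
    simp only [hpβ q hq, hσ2, hone]
    rw [hΓ1]
    simp [hβq]
  refine ⟨U, θ, α, β, Γ, hU, hpU, hUV, hθ, ha.sub S.contDiff.contDiffOn, hβ, fun q _ => hβpos q,
    fun z => ⟨rfl, rfl, fun A hA => ?_⟩, fun q hq hdet => ?_, fun q hq A => ⟨?_, ?_, ?_⟩⟩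
  · obtain ⟨i, rfl⟩ : ∃ i : Fin n, A = i.succ.succ :=
      ⟨⟨A - 2, by omega⟩, by ext; simp; omega⟩
    rfl
  · obtain ⟨v, hv, hMv⟩ := Matrix.exists_mulVec_eq_zero_iff.2 hdet
    have hrow : ∀ A, pd A (fun z => Γ z 0) q * v 0 + (pd A (fun z => Γ z (Fin.succ 0)) q
        * v (Fin.succ 0) + ∑ i : Fin n, pd A (fun z => Γ z i.succ.succ) q * v i.succ.succ) = 0 := by
      intro A
      have := congrFun hMv A
      rwa [Matrix.mulVec, dotProduct, Fin.sum_univ_succ, Fin.sum_univ_succ] at this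
    simp only [hpα q hq, hpβ q hq, hpz] at hrow
    have hlow : ∀ A, (∀ i : Fin n, i.succ.succ ≠ A) →
        (cos (θ q) * Θ1 q A + sin (θ q) * Θ2 q A) * v 0
          + (cos (θ q) * Θ2 q A - sin (θ q) * Θ1 q A) * v (Fin.succ 0) = 0 := by
      intro A hA
      have hz : ∀ i : Fin n, (Pi.single A 1 : Fin (n + 2) → ℝ) i.succ.succ = 0 := fun i =>
        Pi.single_eq_of_ne (hA i) 1
      have hSA : S (Pi.single A 1) = 0 := by simp [hS, hz]
      have h := hrow A
      simp only [hz, hSA, zero_mul, Finset.sum_const_zero] at h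
      refine (mul_eq_zero.1 ?_).resolve_left (hβpos q).ne'
      linear_combination h
    have h0 := hlow 0 fun i => Fin.succ_ne_zero _
    have h1 := hlow (Fin.succ 0) fun i h => Fin.succ_ne_zero i (Fin.succ_injective _ h)
    have hg : Θ1 q 0 * Θ2 q (Fin.succ 0) - Θ1 q (Fin.succ 0) * Θ2 q 0 ≠ 0 := hgen q (hUV hq)
    have hcs := sin_sq_add_cos_sq (θ q)
    have hv0 : v 0 = 0 := by
      refine (mul_eq_zero.1 ?_).resolve_left hg
      linear_combination (cos (θ q) * Θ2 q (Fin.succ 0) - sin (θ q) * Θ1 q (Fin.succ 0)) * h0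
        - (cos (θ q) * Θ2 q 0 - sin (θ q) * Θ1 q 0) * h1
        - (Θ1 q 0 * Θ2 q (Fin.succ 0) - Θ1 q (Fin.succ 0) * Θ2 q 0) * v 0 * hcs
    have hv1 : v (Fin.succ 0) = 0 := by
      refine (mul_eq_zero.1 ?_).resolve_left hg
      linear_combination (cos (θ q) * Θ1 q 0 + sin (θ q) * Θ2 q 0) * h1
        - (cos (θ q) * Θ1 q (Fin.succ 0) + sin (θ q) * Θ2 q (Fin.succ 0)) * h0
        - (Θ1 q 0 * Θ2 q (Fin.succ 0) - Θ1 q (Fin.succ 0) * Θ2 q 0) * v (Fin.succ 0) * hcs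
    refine hv (funext fun A => ?_)
    refine Fin.cases hv0 (Fin.cases hv1 fun i => ?_) A
    have h := hrow i.succ.succ
    rw [hv0, hv1] at h
    simpa [Pi.single_apply] using h
  · rw [hpull1 q hq]
    ring
  · rw [hpull2 q hq]
    ring
  · rw [hσ3, hpull1 q hq, hpθ q hq]
    ring
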